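/- Every simple, cosimple, binary (3,1)-uniform matroid has rank at most 5, and every simple, cosimple, binary (1,3)-uniform matroid has rank at most 11. -/

import Mathlib

open Set

namespace Matroid

variable {α β : Type*}

/-- The rank of a set `X` in a matroid `M` : the maximum cardinality of an
independent subset of `X`. -/
noncomputable def rSet (M : Matroid α) (X : Set α) : ℕ :=
  sSup {n : ℕ | ∃ I, M.Indep I ∧ I ⊆ X ∧ I.ncard = n}

/-- The rank of a matroid. -/
noncomputable def rankM (M : Matroid α) : ℕ := M.rSet M.E

/-- A circuit of `M` : a minimal dependent subset of the ground set. -/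
def CircuitM (M : Matroid α) (C : Set α) : Prop :=
  C ⊆ M.E ∧ ¬ M.Indep C ∧ ∀ D, D ⊂ C → M.Indep D

/-- Deletion of a set from a matroid. -/
def deleteS (M : Matroid α) (D : Set α) : Matroid α := M ↾ (M.E \ D)

/-- Contraction of a set in a matroid. -/
def contractS (M : Matroid α) (C : Set α) : Matroid α := (M✶.deleteS C)✶

/-- `N` is a minor of `M` if it is obtained from `M` by a contraction
followed by a deletion. -/
def IsMinorOf (N M : Matroid α) : Prop :=
  ∃ C D : Set α, C ⊆ M.E ∧ D ⊆ M.E ∧ Disjoint C D ∧ N = (M.contractS C).deleteS D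

/-- `M` is isomorphic to `N` : there is a bijection of the ground sets
preserving independence. -/
def IsoTo (M : Matroid α) (N : Matroid β) : Prop :=
  ∃ e : M.E ≃ N.E, ∀ I : Set M.E,
    M.Indep ((↑) '' I) ↔ N.Indep ((↑) '' (e '' I))

/-- The matroid `U_{k,k} ⊕ U_{0,ℓ}` consisting of `k` coloops and `ℓ` loops. -/
def freeLoopy (k ℓ : ℕ) : Matroid (Fin (k + ℓ)) :=
  uniqueBaseOn {i : Fin (k + ℓ) | (i : ℕ) < k} univ

/-- A matroid is `(k,ℓ)`-uniform if it has no minor isomorphic to `U_{k,k} ⊕ U_{0,ℓ}`. -/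
def KLUniform (k ℓ : ℕ) (M : Matroid α) : Prop :=
  ¬ ∃ N : Matroid α, N.IsMinorOf M ∧ N.IsoTo (freeLoopy k ℓ)

/-- A matroid is paving if every circuit has size at least the rank of the matroid. -/
def PavingM (M : Matroid α) : Prop := ∀ C, M.CircuitM C → M.rankM ≤ C.ncard

/-- A matroid is simple if it has no circuits of size at most two. -/
def SimpleM (M : Matroid α) : Prop := ∀ C, M.CircuitM C → 2 < C.ncard

/-- A matroid is uniform if its independent sets are exactly the subsets of the
ground set of cardinality at most the rank. -/
def UniformM (M : Matroid α) : Prop := ∀ I ⊆ M.E, (M.Indep I ↔ I.ncard ≤ M.rankM)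

/-- A matroid is representable over a field `𝔽` if there is a map from its ground type to
an `𝔽`-vector space under which independence coincides with linear independence. -/
def RepOver (𝔽 : Type*) [Field 𝔽] (M : Matroid α) : Prop :=
  ∃ (W : Type) (_ : AddCommGroup W) (_ : Module 𝔽 W) (φ : α → W),
    ∀ I ⊆ M.E, (M.Indep I ↔ Set.InjOn φ I ∧ LinearIndependent 𝔽 (fun x : I => φ x))


/-- `φ` represents `M` over `GF(2)`. -/
def RepBy {W : Type*} [AddCommGroup W] [Module (ZMod 2) W] (M : Matroid α) (φ : α → W) : Prop :=
  ∀ I ⊆ M.E, (M.Indep I ↔ LinearIndepOn (ZMod 2) φ I)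

/-- `M` has a minor consisting of `k` coloops and `l` loops. -/
def HasFL (k l : ℕ) (M : Matroid α) : Prop :=
  ∃ C D K L : Set α, C ⊆ M.E ∧ D ⊆ M.E ∧ Disjoint C D ∧ Disjoint K L ∧ K.Finite ∧ L.Finite ∧
    K.ncard = k ∧ L.ncard = l ∧ (M.contract C).delete D = uniqueBaseOn K (K ∪ L)

theorem HasFL.dual {k l : ℕ} {M : Matroid α} (h : HasFL k l M✶) : HasFL l k M := by
  obtain ⟨C, D, K, L, hC, hD, hCD, hKL, hK, hL, hk, hl, h⟩ := h
  refine ⟨D, C, L, K, hD, hC, hCD.symm, hKL.symm, hL, hK, hl, hk, ?_⟩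
  have h2 := congrArg Matroid.dual h
  rw [dual_contract_delete, dual_dual, uniqueBaseOn_dual_eq] at h2
  rw [contract_delete_comm _ hCD.symm, h2, union_comm L K]
  congr 1
  ext x
  have : x ∈ K → x ∉ L := fun h1 h2 => Set.disjoint_left.1 hKL h1 h2
  simp only [mem_sdiff, mem_union]
  tauto

theorem HasFL.not_uniform {k l : ℕ} {M : Matroid α} (h : HasFL k l M) : ¬ KLUniform k l M := by
  obtain ⟨C, D, K, L, hC, hD, hCD, hKL, hK, hL, hk, hl, h⟩ := h
  intro hu
  apply hu
  refine ⟨uniqueBaseOn K (K ∪ L), ⟨C, D, hC, hD, hCD, h.symm⟩, ?_⟩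
  have := hK.fintype
  have := hL.fintype
  have eK : K ≃ Fin k := by
    rw [← hk]; exact Fintype.equivFinOfCardEq (by rw [← Nat.card_eq_fintype_card]; rfl)
  have eL : L ≃ Fin l := by
    rw [← hl]; exact Fintype.equivFinOfCardEq (by rw [← Nat.card_eq_fintype_card]; rfl)
  classical
  let e0 : (K ∪ L : Set α) ≃ Fin (k + l) :=
    ((Equiv.Set.union hKL).trans (Equiv.sumCongr eK eL)).trans finSumFinEquiv
  have he0 : ∀ x : (K ∪ L : Set α), (x : α) ∈ K ↔ ((e0 x : Fin (k + l)) : ℕ) < k := by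
    intro x
    by_cases hx : (x : α) ∈ K
    · simp [e0, Equiv.Set.union_apply_left hKL hx, hx]
    · have hx' : (x : α) ∈ L := by
        rcases x.2 with h | h
        · exact absurd h hx
        · exact h
      simp [e0, Equiv.Set.union_apply_right hKL hx', hx]
  let e : (uniqueBaseOn K (K ∪ L)).E ≃ (freeLoopy k l).E :=
    e0.trans (Equiv.Set.univ _).symm
  refine ⟨e, fun I => ?_⟩
  have hfl : ∀ J, (freeLoopy k l).Indep J ↔ J ⊆ {i : Fin (k + l) | (i : ℕ) < k} :=
    fun J => uniqueBaseOn_indep_iff (subset_univ _)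
  rw [uniqueBaseOn_indep_iff subset_union_left, hfl]
  constructor
  · rintro h _ ⟨_, ⟨x, hx, rfl⟩, rfl⟩
    exact (he0 x).1 (h ⟨x, hx, rfl⟩)
  · rintro h _ ⟨x, hx, rfl⟩
    exact (he0 x).2 (h ⟨_, ⟨x, hx, rfl⟩, rfl⟩)

theorem hasFL_of_dep {M : Matroid α} [M.Finite] {B X : Set α} (hB : M.IsBase B)
    (hX : M.Dep X) (hc : X.ncard + 2 ≤ B.ncard) : HasFL 3 1 M := by
  obtain ⟨C, hCX, hC⟩ := hX.exists_isCircuit_subset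
  have hXf : X.Finite := M.ground_finite.subset hX.subset_ground
  have hCc := Set.ncard_le_ncard hCX hXf
  obtain ⟨e, he⟩ := hC.nonempty
  have hI := hC.sdiff_singleton_indep he
  obtain ⟨B', hB', hIB'⟩ := hI.exists_isBase_superset
  have hB'f : B'.Finite := M.ground_finite.subset hB'.subset_ground
  have heB' : e ∉ B' := by
    intro h
    apply hC.dep.not_indep
    apply hB'.indep.subset
    intro x hx
    by_cases hxe : x = e
    · exact hxe ▸ h
    · exact hIB' ⟨hx, hxe⟩
  have hcard : B'.ncard = B.ncard := hB'.ncard_eq_ncard_of_isBase hB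
  have h1 := Set.ncard_sdiff_singleton_add_one he (hXf.subset hCX)
  have h2 := Set.ncard_sdiff_add_ncard_of_subset hIB' hB'f
  obtain ⟨K, hKs, hK3⟩ := Set.exists_subset_card_eq (s := B' \ (C \ {e})) (n := 3) (by omega)
  have hKB : K ⊆ B' := hKs.trans sdiff_subset
  have heK : e ∉ K := fun h => heB' (hKB h)
  have heE : e ∈ M.E := hC.subset_ground he
  refine ⟨B' \ K, (M.E \ B') \ {e}, K, {e}, sdiff_subset.trans hB'.subset_ground,
    sdiff_subset.trans sdiff_subset, ?_, by simpa using heK, hB'f.subset hKB, finite_singleton e,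
    hK3, by simp, ?_⟩
  · rw [Set.disjoint_left]
    rintro x hx hx'
    exact hx'.1.2 hx.1
  refine ext_indep ?_ ?_
  · ext x
    have h1 : x ∈ K → x ∈ B' := fun h => hKB h
    have h2 : x ∈ B' → x ∈ M.E := fun h => hB'.subset_ground h
    simp only [delete_ground, contract_ground, mem_sdiff, mem_singleton_iff, uniqueBaseOn_ground,
      mem_union]
    by_cases hx : x = e
    · subst hx; tauto
    · tauto
  · intro J hJ
    rw [uniqueBaseOn_indep_iff subset_union_left, delete_indep_iff,
      (hB'.indep.subset sdiff_subset).contract_indep_iff]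
    have hJ' : ∀ x ∈ J, x ∈ M.E ∧ (x ∈ B' → x ∈ K) ∧ (x ∈ B' ∨ x = e) := by
      intro x hx
      have := hJ hx
      simp only [delete_ground, contract_ground, mem_sdiff, mem_singleton_iff] at this
      tauto
    constructor
    · rintro ⟨⟨-, h⟩, -⟩ x hx
      rcases (hJ' x hx).2.2 with h' | rfl
      · exact (hJ' x hx).2.1 h'
      exfalso
      apply hC.dep.not_indep
      apply h.subset
      intro y hy
      by_cases hyx : y = x
      · exact Or.inl (hyx ▸ hx)
      · exact Or.inr ⟨hIB' ⟨hy, hyx⟩, fun hyK => (hKs hyK).2 ⟨hy, hyx⟩⟩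
    · intro h
      refine ⟨⟨?_, ?_⟩, ?_⟩
      · rw [Set.disjoint_left]
        intro x hx hx'
        exact hx'.2 (h hx)
      · apply hB'.indep.subset
        exact union_subset (h.trans hKB) sdiff_subset
      · rw [Set.disjoint_left]
        intro x hx hx'
        exact hx'.1.2 (hKB (h hx))

theorem RepBy.closure {W : Type*} [AddCommGroup W] [Module (ZMod 2) W] {M : Matroid α} {φ : α → W}
    (h : RepBy M φ) {X : Set α} (hX : X ⊆ M.E) {e : α} (he : e ∈ M.E) :
    e ∈ M.closure X ↔ φ e ∈ Submodule.span (ZMod 2) (φ '' X) := by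
  have key : ∀ J : Set α, M.Indep J → ∀ e ∈ M.E, (e ∈ M.closure J ↔
      φ e ∈ Submodule.span (ZMod 2) (φ '' J)) := by
    intro J hJ e he
    have hli := (h J hJ.subset_ground).1 hJ
    rw [← not_iff_not, hJ.notMem_closure_iff, hli.notMem_span_iff,
      h _ (insert_subset he hJ.subset_ground)]
  obtain ⟨J, hJ⟩ := M.exists_isBasis X
  rw [← hJ.closure_eq_closure, key J hJ.indep e he]
  have : Submodule.span (ZMod 2) (φ '' J) = Submodule.span (ZMod 2) (φ '' X) := by
    apply le_antisymm (Submodule.span_mono (image_mono hJ.subset))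
    rw [Submodule.span_le]
    rintro _ ⟨x, hx, rfl⟩
    exact (key J hJ.indep x (hX hx)).1 (hJ.subset_closure hx)
  rw [this]

/-- The cycle space. -/
noncomputable def cyc {W : Type*} [AddCommGroup W] [Module (ZMod 2) W] (M : Matroid α) (φ : α → W) :
    Submodule (ZMod 2) (α →₀ ZMod 2) :=
  Finsupp.supported (ZMod 2) (ZMod 2) M.E ⊓ LinearMap.ker (Finsupp.linearCombination (ZMod 2) φ)

theorem RepBy.exists_cyc {W : Type*} [AddCommGroup W] [Module (ZMod 2) W] {M : Matroid α}
    {φ : α → W} (h : RepBy M φ) {X : Set α} (hX : X ⊆ M.E) {e : α} (he : e ∈ M.closure X)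
    (heX : e ∉ X) : ∃ c ∈ cyc M φ, c e = 1 ∧ ∀ x, c x ≠ 0 → x ∈ X ∨ x = e := by
  have heE : e ∈ M.E := mem_ground_of_mem_closure he
  rw [h.closure hX heE, Finsupp.mem_span_image_iff_linearCombination] at he
  obtain ⟨l, hl, hle⟩ := he
  have hl' : ∀ x, l x ≠ 0 → x ∈ X := fun x hx => hl (by simpa using hx)
  have hle0 : l e = 0 := by
    by_contra hne
    exact heX (hl' e hne)
  refine ⟨Finsupp.single e 1 - l, ⟨?_, ?_⟩, ?_, ?_⟩
  · refine Submodule.sub_mem _ ?_ ?_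
    · exact Finsupp.single_mem_supported _ _ heE
    · exact Finsupp.supported_mono hX hl
  · simp [hle]
  · simp [hle0]
  · intro x hx
    by_cases hxe : x = e
    · exact Or.inr hxe
    · left
      apply hl'
      rintro h0
      apply hx
      simp [h0, Finsupp.single_apply, Ne.symm hxe]

theorem RepBy.dual {W : Type*} [AddCommGroup W] [Module (ZMod 2) W] {M : Matroid α} [M.Finite]
    {φ : α → W} (h : RepBy M φ) :
    RepBy M✶ (fun e => (fun c : cyc M φ => (c : α →₀ ZMod 2) e)) := by
  intro I hI
  rw [dual_ground] at hI
  have hIf : I.Finite := M.ground_finite.subset hI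
  rw [← coindep_def, coindep_iff_compl_spanning hI, linearIndepOn_iff']
  constructor
  · intro hs t g ht hg e het
    have heI : e ∈ I := ht het
    obtain ⟨c, hc, hce, hcx⟩ := h.exists_cyc (X := M.E \ I) sdiff_subset (e := e)
      (by rw [hs.closure_eq]; exact hI heI) (fun h' => h'.2 heI)
    have := congrFun hg ⟨c, hc⟩
    simp only [Finset.sum_apply, Pi.smul_apply, Pi.zero_apply, smul_eq_mul] at this
    rw [Finset.sum_eq_single e, hce] at this
    · simpa using this
    · intro b hb hbe
      have : c b = 0 := by
        by_contra h0
        rcases hcx b h0 with h1 | h1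
        · exact h1.2 (ht hb)
        · exact hbe h1
      simp [this]
    · intro h'; exact absurd het h'
  · intro hl
    rw [spanning_iff_ground_subset_closure sdiff_subset]
    intro e he
    by_contra hec
    have heI : e ∈ I := by
      by_contra h'
      exact hec (M.subset_closure (M.E \ I) sdiff_subset ⟨he, h'⟩)
    rw [h.closure sdiff_subset he] at hec
    obtain ⟨f, hf, hfk⟩ := Submodule.exists_le_ker_of_notMem hec
    refine hf ?_
    refine hl hIf.toFinset (fun i => f (φ i)) (by simp) ?_ e (by simpa using heI)
    ext ⟨c, hc⟩
    simp only [Finset.sum_apply, Pi.smul_apply, Pi.zero_apply, smul_eq_mul]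
    have h0 : f (Finsupp.linearCombination (ZMod 2) φ c) = 0 := by
      rw [LinearMap.mem_ker.1 hc.2, map_zero]
    rw [Finsupp.linearCombination_apply, Finsupp.sum, map_sum] at h0
    rw [← h0]
    classical
    have hcE : ∀ x, c x ≠ 0 → x ∈ M.E := fun x hx => hc.1 (by simpa using hx)
    rw [← Finset.sum_subset (s₁ := hIf.toFinset ∩ c.support) Finset.inter_subset_left,
      ← Finset.sum_subset (s₁ := hIf.toFinset ∩ c.support) (s₂ := c.support)
        Finset.inter_subset_right]
    · apply Finset.sum_congr rfl
      intro x _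
      simp [mul_comm]
    · intro x hx hx'
      have hxI : x ∉ I := by
        intro h'; exact hx' (by simpa [h'] using hx)
      have : f (φ x) = 0 := hfk (Submodule.subset_span ⟨x, ⟨hcE x (by simpa using hx), hxI⟩, rfl⟩)
      simp [this]
    · intro x hx hx'
      have : c x = 0 := by
        by_contra h'
        exact hx' (by simp at hx; simp [hx, h'])
      simp [this]

theorem SimpleM.indep {M : Matroid α} [M.Finite] (h : M.SimpleM) {X : Set α} (hX : X ⊆ M.E)
    (hc : X.ncard ≤ 2) : M.Indep X := by
  by_contra hd
  obtain ⟨C, hCX, hC⟩ := ((not_indep_iff hX).1 hd).exists_isCircuit_subset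
  have h1 := h C ⟨hC.subset_ground, hC.dep.not_indep, fun D hD => hC.ssubset_indep hD⟩
  have h2 := Set.ncard_le_ncard hCX (M.ground_finite.subset hX)
  omega

theorem rankM_eq {M : Matroid α} [M.Finite] {B : Set α} (hB : M.IsBase B) :
    M.rankM = B.ncard := by
  unfold rankM rSet
  apply IsGreatest.csSup_eq
  refine ⟨⟨B, hB.indep, hB.subset_ground, rfl⟩, ?_⟩
  rintro n ⟨I, hI, -, rfl⟩
  obtain ⟨B', hB', hIB'⟩ := hI.exists_isBase_superset
  rw [← hB'.ncard_eq_ncard_of_isBase hB]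
  exact Set.ncard_le_ncard hIB' (M.ground_finite.subset hB'.subset_ground)

theorem span_card {W : Type*} [AddCommGroup W] [Module (ZMod 2) W] (φ : α → W) {B : Set α}
    (hB : B.Finite) : (Submodule.span (ZMod 2) (φ '' B) : Set W).Finite ∧
      (Submodule.span (ZMod 2) (φ '' B) : Set W).ncard ≤ 2 ^ B.ncard := by
  have hf : (φ '' B).Finite := hB.image φ
  have : Module.Finite (ZMod 2) (Submodule.span (ZMod 2) (φ '' B)) :=
    Module.Finite.span_of_finite _ hf
  have : Finite (Submodule.span (ZMod 2) (φ '' B)) := Module.finite_of_finite (ZMod 2)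
  refine ⟨Set.toFinite _, ?_⟩
  have h1 : (Submodule.span (ZMod 2) (φ '' B) : Set W).ncard =
    Nat.card (Submodule.span (ZMod 2) (φ '' B)) := rfl
  rw [h1, Module.natCard_eq_pow_finrank (K := ZMod 2)]
  simp only [Nat.card_zmod]
  apply Nat.pow_le_pow_right (by norm_num)
  have := hf.fintype
  refine (finrank_span_le_card (φ '' B)).trans ?_
  rw [← Set.ncard_eq_toFinset_card']
  exact Set.ncard_image_le hB

theorem RepBy.ne_zero {W : Type*} [AddCommGroup W] [Module (ZMod 2) W] {M : Matroid α}
    [M.Finite] {φ : α → W} (h : RepBy M φ) (hs : M.SimpleM) {e : α} (he : e ∈ M.E) : φ e ≠ 0 := by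
  have := (h {e} (by simpa using he)).1 (hs.indep (by simpa using he) (by simp))
  exact this.ne_zero (mem_singleton e)

theorem ncard_pair_le2 (x y : α) : ({x, y} : Set α).ncard ≤ 2 :=
  (Set.ncard_insert_le _ _).trans (by simp)

theorem RepBy.injOn {W : Type*} [AddCommGroup W] [Module (ZMod 2) W] {M : Matroid α}
    [M.Finite] {φ : α → W} (h : RepBy M φ) (hs : M.SimpleM) : InjOn φ M.E := by
  intro x hx y hy hxy
  have hss : ({x, y} : Set α) ⊆ M.E := insert_subset hx (by simpa using hy)
  have := (h _ hss).1 (hs.indep hss (ncard_pair_le2 x y))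
  exact this.injOn (by simp) (by simp) hxy

theorem RepBy.mem_span {W : Type*} [AddCommGroup W] [Module (ZMod 2) W] {M : Matroid α}
    {φ : α → W} (h : RepBy M φ) {B : Set α} (hB : M.IsBase B) {e : α} (he : e ∈ M.E) :
    φ e ∈ Submodule.span (ZMod 2) (φ '' B) := by
  rw [← h.closure hB.subset_ground he, hB.closure_eq]
  exact he

theorem RepBy.card_lt {W : Type*} [AddCommGroup W] [Module (ZMod 2) W] {M : Matroid α}
    [M.Finite] {φ : α → W} (h : RepBy M φ) (hs : M.SimpleM) {B : Set α} (hB : M.IsBase B) :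
    M.E.ncard + 1 ≤ 2 ^ B.ncard := by
  obtain ⟨hf, hc⟩ := span_card φ (M.ground_finite.subset hB.subset_ground)
  refine le_trans ?_ hc
  rw [← (h.injOn hs).ncard_image, ← Set.ncard_insert_of_notMem (a := (0 : W)) ?_
    (M.ground_finite.image φ)]
  · apply Set.ncard_le_ncard _ hf
    apply insert_subset (Submodule.zero_mem _)
    rintro _ ⟨x, hx, rfl⟩
    exact h.mem_span hB hx
  · rintro ⟨x, hx, hx0⟩
    exact h.ne_zero hs hx hx0

theorem RepBy.card_sumfree {W : Type*} [AddCommGroup W] [Module (ZMod 2) W] {M : Matroid α}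
    [M.Finite] {φ : α → W} (h : RepBy M φ) (hs : ∀ X ⊆ M.E, X.ncard ≤ 3 → M.Indep X) {B : Set α}
    (hinj : InjOn φ M.E)
    (hB : M.IsBase B) {a : α} (ha : a ∈ M.E) :
    2 * M.E.ncard ≤ 2 ^ B.ncard := by
  obtain ⟨hf, hc⟩ := span_card φ (M.ground_finite.subset hB.subset_ground)
  refine le_trans ?_ hc
  have hd : Disjoint (φ '' M.E) ((fun x => φ a + φ x) '' M.E) := by
    rw [Set.disjoint_left]
    rintro _ ⟨e, he, rfl⟩ ⟨f, hf, hef⟩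
    have hn3 : ({a, e, f} : Set α).ncard ≤ 3 := by
      refine (Set.ncard_insert_le _ _).trans ?_
      have := ncard_pair_le2 e f
      omega
    have hss : ({a, e, f} : Set α) ⊆ M.E :=
      insert_subset ha (insert_subset he (by simpa using hf))
    have hli := (h _ hss).1 (hs _ hss hn3)
    have hae : a ≠ f := by
      rintro rfl
      have h0 : φ e = 0 := by
        rw [← hef]
        have : (φ a + φ a) = (2 : ZMod 2) • φ a := by rw [two_smul]
        simp only [this]
        rw [show (2 : ZMod 2) = 0 from rfl, zero_smul]
      exact hli.ne_zero (i := e) (by simp) h0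
    by_cases hee : e = f
    · subst hee
      have h0 : φ a = 0 := by simpa using hef
      exact hli.ne_zero (i := a) (by simp) h0
    by_cases hea : e = a
    · subst hea
      have h0 : φ f = 0 := by simpa using hef
      exact hli.ne_zero (i := f) (by simp) h0
    have h3 : LinearIndepOn (ZMod 2) φ (insert e {a, f}) := by
      rwa [Set.insert_comm]
    rw [linearIndepOn_insert (by simp [hee, hea])] at h3
    apply h3.2
    rw [← hef]
    exact Submodule.add_mem _ (Submodule.subset_span ⟨a, by simp, rfl⟩)
      (Submodule.subset_span ⟨f, by simp, rfl⟩)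
  have hinj2 : InjOn (fun x => φ a + φ x) M.E := by
    intro x hx y hy hxy
    exact hinj hx hy (by simpa using hxy)
  have hu := Set.ncard_union_eq hd (M.ground_finite.image _) (M.ground_finite.image _)
  rw [hinj.ncard_image, hinj2.ncard_image] at hu
  rw [two_mul, ← hu]
  apply Set.ncard_le_ncard _ hf
  apply union_subset
  · rintro _ ⟨x, hx, rfl⟩
    exact h.mem_span hB hx
  · rintro _ ⟨x, hx, rfl⟩
    exact Submodule.add_mem _ (h.mem_span hB ha) (h.mem_span hB hx)

set_option maxRecDepth 100000 in
set_option maxHeartbeats 4000000 in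
theorem count8 : ∀ w : Fin 4 → ZMod 2,
    (Finset.univ.filter (fun t : Fin 4 → ZMod 2 => ∑ i, t i * w i ≠ 0)).card ≤ 8 := by
  decide

theorem plotkin {ι : Type*} [Fintype ι] (v : ι → Fin 4 → ZMod 2) (d : ℕ)
    (h : ∀ t : Fin 4 → ZMod 2, t ≠ 0 →
      d ≤ (Finset.univ.filter (fun e => ∑ i, t i * v e i ≠ 0)).card) :
    15 * d ≤ 8 * Fintype.card ι := by
  classical
  have h1 := Finset.sum_card_bipartiteAbove_eq_sum_card_bipartiteBelow
    (s := (Finset.univ : Finset (Fin 4 → ZMod 2))) (t := (Finset.univ : Finset ι))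
    (fun t e => ∑ i, t i * v e i ≠ 0)
  have h2 : ∑ e : ι, (Finset.univ.filter (fun t : Fin 4 → ZMod 2 =>
      ∑ i, t i * v e i ≠ 0)).card ≤ ∑ e : ι, 8 := Finset.sum_le_sum fun e _ => count8 (v e)
  have h3 : ∑ t ∈ (Finset.univ : Finset (Fin 4 → ZMod 2)).erase 0, d ≤
      ∑ t ∈ (Finset.univ : Finset (Fin 4 → ZMod 2)).erase 0,
        (Finset.univ.filter (fun e => ∑ i, t i * v e i ≠ 0)).card :=
    Finset.sum_le_sum fun t ht => h t (Finset.ne_of_mem_erase ht)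
  have h4 : ∑ t ∈ (Finset.univ : Finset (Fin 4 → ZMod 2)).erase 0,
        (Finset.univ.filter (fun e => ∑ i, t i * v e i ≠ 0)).card ≤
      ∑ t : Fin 4 → ZMod 2, (Finset.univ.filter (fun e => ∑ i, t i * v e i ≠ 0)).card :=
    Finset.sum_le_sum_of_subset (Finset.erase_subset _ _)
  simp only [Finset.bipartiteAbove, Finset.bipartiteBelow] at h1
  rw [h1] at h4
  have h5 := h3.trans (h4.trans h2)
  simp only [Finset.sum_const, smul_eq_mul, Finset.card_univ] at h5
  rw [Finset.card_erase_of_mem (Finset.mem_univ _)] at h5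
  simp [ZMod.card] at h5
  omega

theorem plotkin5 {ι : Type*} [Fintype ι] (v : ι → Fin 4 → ZMod 2)
    (h : ∀ t : Fin 4 → ZMod 2, t ≠ 0 →
      5 ≤ (Finset.univ.filter (fun e => ∑ i, t i * v e i ≠ 0)).card) :
    90 ≤ 8 * (Fintype.card ι + 1) := by
  classical
  rw [← Fintype.card_option]
  refine plotkin (ι := Option ι) (fun o => o.elim (∑ e, v e) v) 6 ?_
  intro t ht
  have h5 := h t ht
  have hpar : ((Finset.univ.filter (fun e => ∑ i, t i * v e i ≠ 0)).card : ZMod 2) =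
      ∑ i, t i * (∑ e, v e) i := by
    rw [Finset.card_filter]
    push_cast
    simp only [Finset.sum_apply, Finset.mul_sum]
    rw [Finset.sum_comm]
    apply Finset.sum_congr rfl
    intro e _
    generalize ∑ i, t i * v e i = z
    revert z
    decide
  have hsplit : (Finset.univ.filter (fun o : Option ι =>
      ∑ i, t i * (o.elim (∑ e, v e) v : Fin 4 → ZMod 2) i ≠ 0)).card =
      (if ∑ i, t i * (∑ e, v e) i ≠ 0 then 1 else 0) +
      (Finset.univ.filter (fun e => ∑ i, t i * v e i ≠ 0)).card := by
    rw [Finset.card_filter, Fintype.sum_option, Finset.card_filter]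
    rfl
  rw [hsplit, ← hpar]
  rcases Nat.eq_or_lt_of_le h5 with h6 | h6
  · rw [← h6]; decide
  · omega

theorem RepBy.dep_support {W : Type*} [AddCommGroup W] [Module (ZMod 2) W] {M : Matroid α}
    {φ : α → W} (h : RepBy M φ) {c : α →₀ ZMod 2} (hc : c ∈ cyc M φ) (h0 : c ≠ 0) :
    M.Dep (c.support : Set α) := by
  have hE : (c.support : Set α) ⊆ M.E := hc.1
  refine (not_indep_iff hE).1 fun hi => h0 ?_
  have hl := (h _ hE).1 hi
  rw [linearIndepOn_iff] at hl
  exact hl c (by rw [Finsupp.mem_supported]) hc.2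

theorem core1 {W : Type*} [AddCommGroup W] [Module (ZMod 2) W] {M : Matroid α} [M.Finite]
    {φ : α → W} (h : RepBy M φ) (hcs : M✶.SimpleM) {B : Set α} (hB : M.IsBase B)
    (hd : ∀ X, M.Dep X → B.ncard ≤ X.ncard + 1) : B.ncard ≤ 5 := by
  classical
  by_contra hr
  have hBf : B.Finite := M.ground_finite.subset hB.subset_ground
  have hk := h.dual.card_lt hcs hB.compl_isBase_dual
  have hn := Set.ncard_sdiff_add_ncard_of_subset hB.subset_ground M.ground_finite
  rw [dual_ground] at hk
  have hk4 : 4 ≤ (M.E \ B).ncard := by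
    by_contra hlt
    generalize (M.E \ B).ncard = k at *
    have : k ≤ 3 := by omega
    interval_cases k <;> omega
  obtain ⟨T, hT, hT4⟩ := Set.exists_subset_card_eq hk4
  have hTf : T.Finite := M.ground_finite.subset (hT.trans sdiff_subset)
  have := hTf.fintype
  have x : Fin 4 ≃ T :=
    (Fintype.equivFinOfCardEq (by rw [← hT4, ← Nat.card_eq_fintype_card]; rfl)).symm
  have hex : ∀ i : Fin 4, ∃ c ∈ cyc M φ, c (x i) = 1 ∧ ∀ y, c y ≠ 0 → y ∈ B ∨ y = x i := by
    intro i
    have hi := hT (x i).2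
    exact h.exists_cyc hB.subset_ground (by rw [hB.closure_eq]; exact hi.1) hi.2
  choose c hc hc1 hc0 using hex
  have hUf : (B ∪ T).Finite := hBf.union hTf
  have := hUf.fintype
  have hcard : Fintype.card (B ∪ T : Set α) = B.ncard + 4 := by
    rw [← hT4, ← Set.ncard_union_eq ?_ hBf hTf, ← Nat.card_eq_fintype_card]
    · rfl
    · rw [Set.disjoint_left]
      exact fun y hy hy' => (hT hy').2 hy
  have key : ∀ t : Fin 4 → ZMod 2, t ≠ 0 → B.ncard ≤ (Finset.univ.filter
      (fun e : (B ∪ T : Set α) => ∑ i, t i * c i e ≠ 0)).card + 1 := by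
    intro t ht
    have hval : ∀ y, (∑ i, t i • c i : α →₀ ZMod 2) y = ∑ i, t i * c i y := by
      intro y
      simp [Finsupp.finset_sum_apply]
    have hmem : (∑ i, t i • c i : α →₀ ZMod 2) ∈ cyc M φ :=
      Submodule.sum_mem _ fun i _ => Submodule.smul_mem _ _ (hc i)
    have hne : (∑ i, t i • c i : α →₀ ZMod 2) ≠ 0 := by
      obtain ⟨j, hj⟩ := Function.ne_iff.1 ht
      intro h0
      have h1 := hval (x j)
      rw [h0, Finset.sum_eq_single j] at h1
      · rw [hc1] at h1
        apply hj
        simpa using h1.symm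
      · intro i _ hij
        have : c i (x j) = 0 := by
          by_contra h2
          rcases hc0 i _ h2 with h3 | h3
          · exact (hT (x j).2).2 h3
          · exact hij (x.injective (Subtype.ext h3)).symm
        simp [this]
      · simp
    refine (hd _ (h.dep_support hmem hne)).trans ?_
    apply Nat.add_le_add_right
    rw [Set.ncard_coe_finset, ← Finset.card_map (Function.Embedding.subtype _)]
    apply Finset.card_le_card
    intro y hy
    rw [Finsupp.mem_support_iff, hval] at hy
    obtain ⟨i, -, hi⟩ := Finset.exists_ne_zero_of_sum_ne_zero hy
    have hyU : y ∈ B ∪ T := by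
      rcases hc0 i y (right_ne_zero_of_mul hi) with h3 | h3
      · exact Or.inl h3
      · exact Or.inr (h3 ▸ (x i).2)
    simp only [Finset.mem_map, Finset.mem_filter, Finset.mem_univ, true_and]
    exact ⟨⟨y, hyU⟩, hy, rfl⟩
  rcases Nat.lt_or_ge B.ncard 7 with h7 | h7
  · have := plotkin5 (fun (e : (B ∪ T : Set α)) i => c i e) fun t ht => by
      have := key t ht
      omega
    omega
  · have := plotkin (fun (e : (B ∪ T : Set α)) i => c i e) (B.ncard - 1) fun t ht => by
      have := key t ht
      omega
    omega

theorem main1 {W : Type*} [AddCommGroup W] [Module (ZMod 2) W] {M : Matroid α} [M.Finite]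
    {φ : α → W} (h : RepBy M φ) (hcs : M✶.SimpleM) {B : Set α} (hB : M.IsBase B)
    (hu : ¬ HasFL 3 1 M) : B.ncard ≤ 5 := by
  refine core1 h hcs hB fun X hX => ?_
  by_contra hlt
  exact hu (hasFL_of_dep hB hX (by omega))

theorem main2 {W : Type*} [AddCommGroup W] [Module (ZMod 2) W] {M : Matroid α} [M.Finite]
    {φ : α → W} (h : RepBy M φ) (hs : M.SimpleM) (hcs : M✶.SimpleM) {B : Set α} (hB : M.IsBase B)
    (hu : ¬ HasFL 3 1 M) : (M.E \ B).ncard ≤ 11 := by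
  have h5 := main1 h hcs hB hu
  have hn := Set.ncard_sdiff_add_ncard_of_subset hB.subset_ground M.ground_finite
  rcases Nat.lt_or_ge B.ncard 5 with hlt | hge
  · have h1 := h.card_lt hs hB
    generalize B.ncard = r at *
    interval_cases r <;> omega
  · have hB5 : B.ncard = 5 := le_antisymm h5 hge
    obtain ⟨a, ha⟩ := Set.nonempty_of_ncard_ne_zero (s := B) (by omega)
    have h1 := h.card_sumfree (fun X hX hX3 => by
      by_contra hd
      exact hu (hasFL_of_dep hB ((not_indep_iff hX).1 hd) (by omega))) (h.injOn hs) hB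
      (hB.subset_ground ha)
    rw [hB5] at h1
    omega

/-- a simple cosimple binary `(3,1)`-uniform matroid has rank at most `5`,
and a simple cosimple binary `(1,3)`-uniform matroid has rank at most `11`. -/
theorem stmt14 {α : Type*} (M : Matroid α) (hfin : M.Finite)
    (hs : M.SimpleM) (hcs : M✶.SimpleM) (hbin : Matroid.RepOver (ZMod 2) M) :
    (M.KLUniform 3 1 → M.rankM ≤ 5) ∧ (M.KLUniform 1 3 → M.rankM ≤ 11) := by
  obtain ⟨W, _, _, φ, hφ⟩ := hbin
  have hrep : RepBy M φ := by
    intro I hI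
    rw [hφ I hI]
    exact ⟨fun h => h.2, fun h => ⟨h.injOn, h⟩⟩
  obtain ⟨B, hB⟩ := M.exists_isBase
  rw [rankM_eq hB]
  constructor
  · intro hu
    exact main1 hrep hcs hB fun h => h.not_uniform hu
  · intro hu
    have h1 := main2 hrep.dual hcs (by rwa [dual_dual]) hB.compl_isBase_dual
      fun h => h.dual.not_uniform hu
    rwa [dual_ground, sdiff_sdiff_cancel_left hB.subset_ground] at h1

end Matroid
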